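/- arXiv:0804.4311 — 2 statements merged into one kernel-verified Lean document; each statement's English description precedes it below -/
import Mathlib

section
/- Let U(k) be the Fourier-transformed one-step evolution matrix of the Hadamard walk. For every real k and every even nonnegative integer t, U(k)^t equals the 2×2 matrix with entries (1,1): e^{−iω_k t} + 2iA_k·sin(ω_k t); (1,2): 2i·conj(C_k)·sin(ω_k t); (2,1): 2iC_k·sin(ω_k t); (2,2): e^{iω_k t} − 2iA_k·sin(ω_k t). -/
noncomputable section

open Complex Filter

/-- Amplitude functions on the position × coin space `ℤ × {1,2}`
(coin `0` = "right", coin `1` = "left"). -/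
abbrev QState := ℤ × Fin 2 → ℂ

/-- One step of the Hadamard walk: `(hadamardStep ψ) (x,n) = ⟨x,n|U ψ⟩`, where `U = S ∘ C`
with `S` the chirality-conditioned shift and `C` the Hadamard coin. -/
def hadamardStep (ψ : QState) : QState := fun v =>
  if v.2 = 0 then (ψ (v.1 - 1, 0) + ψ (v.1 - 1, 1)) / (Real.sqrt 2 : ℂ)
  else (ψ (v.1 + 1, 0) - ψ (v.1 + 1, 1)) / (Real.sqrt 2 : ℂ)

/-- The basis state `|x,n⟩`. -/
def ket (x : ℤ) (n : Fin 2) : QState := fun v => if v = (x, n) then 1 else 0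

/-- Pure Hadamard-walk probabilities `W_{m,n}(x,t) = |⟨x,n|U^t|0,m⟩|²`. -/
def W (m n : Fin 2) (x : ℤ) (t : ℕ) : ℝ := ‖(hadamardStep^[t] (ket 0 m)) (x, n)‖ ^ 2

/-- Measurement operators, indexed by `𝔸 = {c} ∪ ℤ×{1,2}`:
`none` is the coherent projection `A_c = √(1-p)·I`, and `some (x,n)` is the
decoherence projection `A_{x,n} = √p |x,n⟩⟨x,n|`. -/
def measOp (p : ℝ) : Option (ℤ × Fin 2) → QState → QState
  | none => fun ψ v => (Real.sqrt (1 - p) : ℂ) * ψ v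
  | some w => fun ψ v => if v = w then (Real.sqrt p : ℂ) * ψ w else 0

/-- The amplitude `(A_{j_t}U)⋯(A_{j_1}U)|0,m⟩` along the path `j`. -/
def pathAmp (p : ℝ) (m : Fin 2) : (t : ℕ) → (Fin t → Option (ℤ × Fin 2)) → QState
  | 0, _ => ket 0 m
  | t + 1, j => measOp p (j (Fin.last t)) (hadamardStep (pathAmp p m t fun i => j i.castSucc))

/-- Decoherent Hadamard-walk probabilities
`P_{m,n}(x,t) = Σ_{j∈𝔸^t} |⟨x,n|(A_{j_t}U)⋯(A_{j_1}U)|0,m⟩|²`. -/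
def Pdec (p : ℝ) (m n : Fin 2) (x : ℤ) (t : ℕ) : ℝ :=
  ∑' j : Fin t → Option (ℤ × Fin 2), ‖pathAmp p m t j (x, n)‖ ^ 2

/-- `Ŵ_{m,n}(k,t) = Σ_x W_{m,n}(x,t) e^{ikx}`. -/
def What (m n : Fin 2) (k : ℝ) (t : ℕ) : ℂ :=
  ∑' x : ℤ, (W m n x t : ℂ) * Complex.exp (Complex.I * k * x)

/-- `P̂_{m,n}(k,z) = Σ_{t≥0} Σ_x P_{m,n}(x,t) e^{ikx} z^t`. -/
def Phat (p : ℝ) (m n : Fin 2) (k : ℝ) (z : ℂ) : ℂ :=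
  ∑' t : ℕ, (∑' x : ℤ, (Pdec p m n x t : ℂ) * Complex.exp (Complex.I * k * x)) * z ^ t

/-- `Q̂_{m,n}(k,z) = (p/q) Σ_{t≥1} Ŵ_{m,n}(k,t) (qz)^t = p Σ_{t≥1} Ŵ_{m,n}(k,t) q^{t-1} z^t`
with `q = 1-p`. -/
def Qhat (p : ℝ) (m n : Fin 2) (k : ℝ) (z : ℂ) : ℂ :=
  (p : ℂ) * ∑' t : ℕ, What m n k (t + 1) * ((1 - p : ℝ) : ℂ) ^ t * z ^ (t + 1)

/-- The matrix `P(k,z) = (P̂_{m,n}(k,z))`. -/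
def Pmat (p k : ℝ) (z : ℂ) : Matrix (Fin 2) (Fin 2) ℂ := Matrix.of fun m n => Phat p m n k z

/-- The matrix `Q(k,z) = (Q̂_{m,n}(k,z))`. -/
def Qmat (p k : ℝ) (z : ℂ) : Matrix (Fin 2) (Fin 2) ℂ := Matrix.of fun m n => Qhat p m n k z

/-- Maximum row-sum norm of a 2×2 complex matrix. -/
def rowSumNorm (A : Matrix (Fin 2) (Fin 2) ℂ) : ℝ :=
  max (‖A 0 0‖ + ‖A 0 1‖) (‖A 1 0‖ + ‖A 1 1‖)

/-- Distribution of the symmetric decoherent Hadamard walk: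
`P(X_t = x) = (1/2) Σ_{m,n} P_{m,n}(x,t)`. -/
def PsymProb (p : ℝ) (x : ℤ) (t : ℕ) : ℝ := (1/2) * ∑ m : Fin 2, ∑ n : Fin 2, Pdec p m n x t

/-- Mean position of the symmetric decoherent walk. -/
def symMean (p : ℝ) (t : ℕ) : ℝ := ∑' x : ℤ, (x : ℝ) * PsymProb p x t

/-- Variance of the symmetric decoherent walk. -/
def symVar (p : ℝ) (t : ℕ) : ℝ :=
  (∑' x : ℤ, (x : ℝ) ^ 2 * PsymProb p x t) - (∑' x : ℤ, (x : ℝ) * PsymProb p x t) ^ 2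

/-- The symmetric generating function `P̂(k,z) = (1/2) Σ_{m,n} P̂_{m,n}(k,z)`. -/
def PhatSym (p k : ℝ) (z : ℂ) : ℂ := (1/2) * ∑ m : Fin 2, ∑ n : Fin 2, Phat p m n k z

/-- Characteristic function `P̂(k,t)` of the symmetric decoherent walk. -/
def charSym (p k : ℝ) (t : ℕ) : ℂ :=
  ∑' x : ℤ, (PsymProb p x t : ℂ) * Complex.exp (Complex.I * k * x)

/-- Distribution of the decoherent walk started at `|0,1⟩`: `P(X̃_t = x) = Σ_n P_{1,n}(x,t)`. -/
def Ptilde (p : ℝ) (x : ℤ) (t : ℕ) : ℝ := ∑ n : Fin 2, Pdec p 0 n x t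

/-- Mean position of the decoherent walk started at `|0,1⟩`. -/
def tildeMean (p : ℝ) (t : ℕ) : ℝ := ∑' x : ℤ, (x : ℝ) * Ptilde p x t

/-- Variance of the decoherent walk started at `|0,1⟩`. -/
def tildeVar (p : ℝ) (t : ℕ) : ℝ :=
  (∑' x : ℤ, (x : ℝ) ^ 2 * Ptilde p x t) - (∑' x : ℤ, (x : ℝ) * Ptilde p x t) ^ 2

/-- Characteristic function of the decoherent walk started at `|0,1⟩`. -/
def charTilde (p k : ℝ) (t : ℕ) : ℂ :=
  ∑' x : ℤ, (Ptilde p x t : ℂ) * Complex.exp (Complex.I * k * x)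

/-- The symmetric initial state `φ₀ = (|0,1⟩ + i|0,2⟩)/√2`. -/
def phi0 : QState := fun v =>
  if v = ((0 : ℤ), (0 : Fin 2)) then (1 / Real.sqrt 2 : ℂ)
  else if v = ((0 : ℤ), (1 : Fin 2)) then Complex.I / Real.sqrt 2 else 0

/-- Distribution of the pure symmetric Hadamard walk: `P(Q_t = x) = Σ_n |⟨x,n|U^t|φ₀⟩|²`. -/
def Ppure (x : ℤ) (t : ℕ) : ℝ := ∑ n : Fin 2, ‖(hadamardStep^[t] phi0) (x, n)‖ ^ 2

/-- Variance of the pure symmetric Hadamard walk. -/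
def pureVar (t : ℕ) : ℝ :=
  (∑' x : ℤ, (x : ℝ) ^ 2 * Ppure x t) - (∑' x : ℤ, (x : ℝ) * Ppure x t) ^ 2

/-- `E(k,z) = √((q²z² − (1+cos k)qz + 1)(q²z² + (1+cos k)qz + 1))`, principal branch. -/
def Efun (q k : ℝ) (z : ℂ) : ℂ :=
  (((q : ℂ) ^ 2 * z ^ 2 - (1 + (Real.cos k : ℂ)) * (q : ℂ) * z + 1) *
    ((q : ℂ) ^ 2 * z ^ 2 + (1 + (Real.cos k : ℂ)) * (q : ℂ) * z + 1)) ^ ((1 : ℂ) / 2)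


/-- The Fourier-transformed one-step evolution matrix of the Hadamard walk. -/
def Uk (k : ℝ) : Matrix (Fin 2) (Fin 2) ℂ :=
  !![Complex.exp (Complex.I * k) / (Real.sqrt 2 : ℂ),
      Complex.exp (Complex.I * k) / (Real.sqrt 2 : ℂ);
     Complex.exp (-(Complex.I * k)) / (Real.sqrt 2 : ℂ),
      -Complex.exp (-(Complex.I * k)) / (Real.sqrt 2 : ℂ)]

/-- `ω_k = arcsin(sin k / √2)`. -/
def omegaK (k : ℝ) : ℝ := Real.arcsin (Real.sin k / Real.sqrt 2)

/-- `A_k = 1/2 + cos k / (2√(1 + cos²k))`. -/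
def Ak (k : ℝ) : ℝ := 1 / 2 + Real.cos k / (2 * Real.sqrt (1 + Real.cos k ^ 2))

/-- `C_k = e^{-ik} / (2√(1 + cos²k))`. -/
def Ck (k : ℝ) : ℂ :=
  Complex.exp (-(Complex.I * k)) / ((2 * Real.sqrt (1 + Real.cos k ^ 2) : ℝ) : ℂ)

/-- De Moivre's formula for an involution `N` in place of `1`. -/
theorem cos_add_sin_smul_pow {R : Type*} [Ring R] [Algebra ℂ R] {N : R} (hN : N * N = 1)
    (θ : ℂ) (n : ℕ) :
    (Complex.cos θ • (1 : R) + (Complex.I * Complex.sin θ) • N) ^ n =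
      Complex.cos (n * θ) • (1 : R) + (Complex.I * Complex.sin (n * θ)) • N := by
  induction n with
  | zero => simp
  | succ n ih =>
    have hθ : ((n + 1 : ℕ) : ℂ) * θ = n * θ + θ := by push_cast; ring
    rw [pow_succ, ih, hθ, Complex.cos_add, Complex.sin_add]
    simp only [add_mul, mul_add, smul_mul_smul_comm, one_mul, mul_one, hN]
    match_scalars
    · linear_combination (Complex.sin (n * θ) * Complex.sin θ) * Complex.I_sq
    · ring

theorem sin_omegaK (k : ℝ) : Real.sin (omegaK k) = Real.sin k / √2 := by
  have h2 : (0 : ℝ) < √2 := by positivity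
  have h1 : (1 : ℝ) ≤ √2 := Real.one_le_sqrt.2 (by norm_num)
  refine Real.sin_arcsin ?_ ?_
  · rw [le_div_iff₀ h2]
    linarith [Real.neg_one_le_sin k]
  · rw [div_le_iff₀ h2]
    linarith [Real.sin_le_one k]

theorem cos_omegaK (k : ℝ) : Real.cos (omegaK k) = √(1 + Real.cos k ^ 2) / √2 := by
  have h : 1 - (Real.sin k / √2) ^ 2 = (1 + Real.cos k ^ 2) / 2 := by
    rw [div_pow, Real.sq_sqrt (by norm_num), Real.sin_sq]
    ring
  rw [omegaK, Real.cos_arcsin, h, Real.sqrt_div (by positivity)]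

/-- The traceless involution that generates the even powers of `Uk k`. -/
def evenGen (k : ℝ) : Matrix (Fin 2) (Fin 2) ℂ :=
  !![2 * (Ak k : ℂ) - 1, 2 * (starRingEnd ℂ) (Ck k); 2 * Ck k, 1 - 2 * (Ak k : ℂ)]

theorem conj_Ck (k : ℝ) : (starRingEnd ℂ) (Ck k) =
    Complex.exp (Complex.I * k) / ((2 * √(1 + Real.cos k ^ 2) : ℝ) : ℂ) := by
  rw [Ck, map_div₀, ← Complex.exp_conj, Complex.conj_ofReal]
  simp

theorem evenGen_eq (k : ℝ) : evenGen k = ((√(1 + Real.cos k ^ 2) : ℝ) : ℂ)⁻¹ •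
    !![(Real.cos k : ℂ), Complex.exp (Complex.I * k);
       Complex.exp (-(Complex.I * k)), -(Real.cos k : ℂ)] := by
  have hr : ((√(1 + Real.cos k ^ 2) : ℝ) : ℂ) ≠ 0 := by
    exact_mod_cast (show √(1 + Real.cos k ^ 2) ≠ 0 by positivity)
  rw [evenGen, conj_Ck, Ck, Ak]
  ext i j
  fin_cases i <;> fin_cases j <;> simp [-Complex.ofReal_cos] <;> field_simp <;> ring

theorem evenGen_mul_self (k : ℝ) : evenGen k * evenGen k = 1 := by
  have hr : ((√(1 + Real.cos k ^ 2) : ℝ) : ℂ) ≠ 0 := by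
    exact_mod_cast (show √(1 + Real.cos k ^ 2) ≠ 0 by positivity)
  have hr2 : ((√(1 + Real.cos k ^ 2) : ℝ) : ℂ) ^ 2 = 1 + (Real.cos k : ℂ) ^ 2 := by
    exact_mod_cast Real.sq_sqrt (show (0 : ℝ) ≤ 1 + Real.cos k ^ 2 by positivity)
  have he : Complex.exp (Complex.I * k) * Complex.exp (-(Complex.I * k)) = 1 := by
    rw [← Complex.exp_add, add_neg_cancel, Complex.exp_zero]
  rw [evenGen_eq, smul_mul_smul_comm, Matrix.mul_fin_two, ← mul_inv, ← sq,
    inv_smul_eq_iff₀ (pow_ne_zero 2 hr), hr2]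
  ext i j
  fin_cases i <;> fin_cases j <;> simp [-Complex.ofReal_cos]
  · linear_combination he
  · ring
  · ring
  · linear_combination he

theorem Uk_sq (k : ℝ) : Uk k ^ 2 = Complex.cos (2 * omegaK k) • (1 : Matrix (Fin 2) (Fin 2) ℂ) +
    (Complex.I * Complex.sin (2 * omegaK k)) • evenGen k := by
  have hr : ((√(1 + Real.cos k ^ 2) : ℝ) : ℂ) ≠ 0 := by
    exact_mod_cast (show √(1 + Real.cos k ^ 2) ≠ 0 by positivity)
  have h2 : ((√2 : ℝ) : ℂ) ≠ 0 := by
    exact_mod_cast (show √(2 : ℝ) ≠ 0 by positivity)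
  have h22 : ((√2 : ℝ) : ℂ) ^ 2 = 2 := by
    exact_mod_cast Real.sq_sqrt (show (0 : ℝ) ≤ 2 by norm_num)
  have hcos : Complex.cos (2 * omegaK k) = 1 - (Real.sin k : ℂ) ^ 2 := by
    rw [Complex.cos_two_mul, Complex.cos_sq', ← Complex.ofReal_sin, sin_omegaK,
      Complex.ofReal_div, div_pow, h22]
    ring
  have hsin : Complex.sin (2 * omegaK k) =
      (Real.sin k : ℂ) * ((√(1 + Real.cos k ^ 2) : ℝ) : ℂ) := by
    rw [Complex.sin_two_mul, ← Complex.ofReal_sin, ← Complex.ofReal_cos, sin_omegaK, cos_omegaK,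
      Complex.ofReal_div, Complex.ofReal_div]
    field_simp
    rw [h22, mul_comm]
  have hp : Complex.exp (Complex.I * k) = (Real.cos k : ℂ) + Real.sin k * Complex.I := by
    rw [mul_comm, Complex.exp_mul_I, Complex.ofReal_cos, Complex.ofReal_sin]
  have hm : Complex.exp (-(Complex.I * k)) = (Real.cos k : ℂ) - Real.sin k * Complex.I := by
    rw [mul_comm, ← neg_mul, Complex.exp_mul_I, Complex.cos_neg, Complex.sin_neg,
      Complex.ofReal_cos, Complex.ofReal_sin]
    ring
  have hcs : (Real.cos k : ℂ) ^ 2 + (Real.sin k : ℂ) ^ 2 = 1 := by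
    exact_mod_cast Real.cos_sq_add_sin_sq k
  have hU : Uk k = ((√2 : ℝ) : ℂ)⁻¹ • !![Complex.exp (Complex.I * k), Complex.exp (Complex.I * k);
      Complex.exp (-(Complex.I * k)), -Complex.exp (-(Complex.I * k))] := by
    ext i j
    fin_cases i <;> fin_cases j <;> simp [Uk] <;> ring
  rw [hcos, hsin, evenGen_eq, smul_smul, ← mul_assoc, mul_inv_cancel_right₀ hr, hU, smul_pow,
    inv_pow, h22, sq, Matrix.mul_fin_two, hp, hm, inv_smul_eq_iff₀ two_ne_zero]
  generalize (Real.cos k : ℂ) = c at *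
  generalize (Real.sin k : ℂ) = s at *
  ext i j
  fin_cases i <;> fin_cases j <;> simp
  · linear_combination 2 * hcs
  · ring
  · ring
  · linear_combination 2 * hcs

/-- Closed form of `U(k)^t` for even nonnegative `t`. -/
theorem Uk_pow_even (k : ℝ) (t : ℕ) (ht : Even t) :
    Uk k ^ t =
      !![Complex.exp (-(Complex.I * (omegaK k) * t))
            + 2 * Complex.I * ((Ak k : ℝ) : ℂ) * ((Real.sin (omegaK k * t) : ℝ) : ℂ),
          2 * Complex.I * (starRingEnd ℂ) (Ck k) * ((Real.sin (omegaK k * t) : ℝ) : ℂ);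
         2 * Complex.I * Ck k * ((Real.sin (omegaK k * t) : ℝ) : ℂ),
          Complex.exp (Complex.I * (omegaK k) * t)
            - 2 * Complex.I * ((Ak k : ℝ) : ℂ) * ((Real.sin (omegaK k * t) : ℝ) : ℂ)] := by
  obtain ⟨n, rfl⟩ := ht
  have hω : (n : ℂ) * (2 * omegaK k) = omegaK k * ((2 * n : ℕ) : ℂ) := by push_cast; ring
  rw [← two_mul, pow_mul, Uk_sq, cos_add_sin_smul_pow (evenGen_mul_self k), hω, evenGen]
  have hp : Complex.exp (Complex.I * omegaK k * ((2 * n : ℕ) : ℂ)) =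
      Complex.cos (omegaK k * ((2 * n : ℕ) : ℂ)) +
        Complex.sin (omegaK k * ((2 * n : ℕ) : ℂ)) * Complex.I := by
    rw [← Complex.exp_mul_I]
    ring_nf
  have hm : Complex.exp (-(Complex.I * omegaK k * ((2 * n : ℕ) : ℂ))) =
      Complex.cos (omegaK k * ((2 * n : ℕ) : ℂ)) -
        Complex.sin (omegaK k * ((2 * n : ℕ) : ℂ)) * Complex.I := by
    rw [sub_eq_add_neg, ← neg_mul (Complex.sin _), ← Complex.sin_neg, ← Complex.cos_neg,
      ← Complex.exp_mul_I]
    ring_nf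
  rw [hp, hm, Complex.ofReal_sin, Complex.ofReal_mul, Complex.ofReal_natCast]
  ext i j
  fin_cases i <;> fin_cases j <;> simp <;> ring

end
end

section
/- Let X_t be the symmetric decoherent Hadamard walk on the line with 0 < p ≤ 1 and q = 1 − p. Then for every complex z with |z| < 1, the generating function of the second moments satisfies Σ_{t≥0} (Σ_{x∈ℤ} x²·P(X_t = x))·z^t = z/(1−z)² + 2z²(√(1 + q²z²) − 1)/((1−z)²·(pz + (1−z)√(1 + q²z²))), where √(1 + q²z²) is taken via the principal branch. -/
noncomputable section

open Complex Filter

/-- Sign of the Hadamard matrix entry `(a, b)`. -/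
def coinSign (a b : Fin 2) : ℂ := if a = 1 ∧ b = 1 then -1 else 1

/-- Displacement caused by the coin state `a`. -/
def drift (a : Fin 2) : ℤ := if a = 0 then 1 else -1

lemma hadamardStep_eq_sum (ψ : QState) (v : ℤ × Fin 2) :
    hadamardStep ψ v = (∑ b, coinSign v.2 b * ψ (v.1 - drift v.2, b)) / (Real.sqrt 2 : ℂ) := by
  obtain ⟨x, a⟩ := v
  fin_cases a <;> simp [hadamardStep, coinSign, drift, Fin.sum_univ_two, sub_eq_add_neg]

/-- The conjugation `ρ ↦ U ρ U*` on kernels. -/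
def conjStep (ρ : ℤ × Fin 2 → ℤ × Fin 2 → ℂ) (v w : ℤ × Fin 2) : ℂ :=
  (1 / 2) * ∑ a, ∑ b, coinSign v.2 a * coinSign w.2 b *
    ρ (v.1 - drift v.2, a) (w.1 - drift w.2, b)

/-- One step of the decoherent evolution on density kernels. -/
def densityStep (p : ℝ) (ρ : ℤ × Fin 2 → ℤ × Fin 2 → ℂ) (v w : ℤ × Fin 2) : ℂ :=
  (if v = w then 1 else 1 - (p : ℂ)) * conjStep ρ v w

/-- Density kernel of the decoherent walk started at `|0,m⟩`. -/
def density (p : ℝ) (m : Fin 2) : ℕ → ℤ × Fin 2 → ℤ × Fin 2 → ℂ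
  | 0 => fun v w => ket 0 m v * ket 0 m w
  | t + 1 => densityStep p (density p m t)

lemma conj_coinSign (a b : Fin 2) : starRingEnd ℂ (coinSign a b) = coinSign a b := by
  unfold coinSign; split_ifs <;> simp

lemma hadamardStep_mul_conj (ψ : QState) (v w : ℤ × Fin 2) :
    hadamardStep ψ v * starRingEnd ℂ (hadamardStep ψ w)
      = conjStep (fun a b => ψ a * starRingEnd ℂ (ψ b)) v w := by
  have h2 : (Real.sqrt 2 : ℂ) * Real.sqrt 2 = 2 := by
    rw [← Complex.ofReal_mul, Real.mul_self_sqrt (by norm_num)]; norm_num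
  rw [hadamardStep_eq_sum, hadamardStep_eq_sum, conjStep]
  simp only [map_div₀, map_sum, map_mul, conj_coinSign, Complex.conj_ofReal]
  rw [div_mul_div_comm, h2, Finset.sum_mul_sum, div_eq_mul_inv, mul_comm, one_div]
  congr 1
  refine Finset.sum_congr rfl fun a _ => Finset.sum_congr rfl fun b _ => by ring

lemma hasSum_conjStep {ι : Type*} {f : ι → ℤ × Fin 2 → ℤ × Fin 2 → ℂ}
    {ρ : ℤ × Fin 2 → ℤ × Fin 2 → ℂ} (h : ∀ v w, HasSum (fun j => f j v w) (ρ v w))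
    (v w : ℤ × Fin 2) : HasSum (fun j => conjStep (f j) v w) (conjStep ρ v w) := by
  unfold conjStep
  exact (hasSum_sum fun a _ => hasSum_sum fun b _ => (h _ _).mul_left _).mul_left _

lemma measOp_mul_conj {p : ℝ} (hp0 : 0 ≤ p) (hp1 : p ≤ 1) (o : Option (ℤ × Fin 2)) (ψ : QState)
    (v w : ℤ × Fin 2) :
    measOp p o ψ v * starRingEnd ℂ (measOp p o ψ w)
      = (if o = none then (1 - (p : ℂ)) else 0) * (ψ v * starRingEnd ℂ (ψ w))
        + (if o = some v then (if v = w then (p : ℂ) else 0) else 0)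
          * (ψ v * starRingEnd ℂ (ψ w)) := by
  have hp : (Real.sqrt p : ℂ) * Real.sqrt p = p := by
    rw [← Complex.ofReal_mul, Real.mul_self_sqrt hp0]
  have hq : (Real.sqrt (1 - p) : ℂ) * Real.sqrt (1 - p) = 1 - p := by
    rw [← Complex.ofReal_mul, Real.mul_self_sqrt (by linarith)]; push_cast; rfl
  cases o with
  | none =>
    simp only [measOp, map_mul, Complex.conj_ofReal, if_true, reduceCtorEq, if_false]
    linear_combination (ψ v * starRingEnd ℂ (ψ w)) * hq
  | some u =>
    simp only [measOp, reduceCtorEq, if_false, Option.some.injEq]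
    by_cases hv : v = u
    · subst hv
      by_cases hw : w = v
      · subst hw
        simp only [if_true, map_mul, Complex.conj_ofReal]
        linear_combination (ψ w * starRingEnd ℂ (ψ w)) * hp
      · simp [hw, Ne.symm hw]
    · simp [hv, Ne.symm hv]

lemma hasSum_prod_single {ι κ : Type*} [DecidableEq κ] (k : κ) (c : ℂ) {f : ι → ℂ} {s : ℂ}
    (h : HasSum f s) : HasSum (fun x : κ × ι => (if x.1 = k then c else 0) * f x.2) (c * s) := by
  have hinj : Function.Injective (fun j : ι => (k, j)) := Prod.mk_right_injective k
  refine (hinj.hasSum_iff ?_).mp (by simpa [Function.comp_def] using h.mul_left c)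
  rintro ⟨k', j⟩ hx
  have : k' ≠ k := by rintro rfl; exact hx ⟨j, rfl⟩
  simp [this]

lemma hasSum_density {p : ℝ} (hp0 : 0 ≤ p) (hp1 : p ≤ 1) (m : Fin 2) (t : ℕ)
    (v w : ℤ × Fin 2) :
    HasSum (fun j => pathAmp p m t j v * starRingEnd ℂ (pathAmp p m t j w))
      (density p m t v w) := by
  induction t generalizing v w with
  | zero =>
    have : ∀ u, starRingEnd ℂ (ket 0 m u) = ket 0 m u := by
      intro u; unfold ket; split_ifs <;> simp
    simp [pathAmp, density, this]
  | succ t ih =>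
    rw [← (Fin.snocEquiv fun _ => Option (ℤ × Fin 2)).hasSum_iff]
    have key := hasSum_conjStep ih v w
    have h1 := (hasSum_prod_single (none : Option (ℤ × Fin 2)) (1 - (p : ℂ)) key).add
      (hasSum_prod_single (some v) (if v = w then (p : ℂ) else 0) key)
    convert h1 using 1
    · ext ⟨o, j⟩
      simp only [Function.comp_apply, Fin.snocEquiv, Equiv.coe_fn_mk, pathAmp, Fin.snoc_last,
        Fin.snoc_castSucc]
      rw [measOp_mul_conj hp0 hp1, hadamardStep_mul_conj]
    · simp only [density, densityStep]
      split_ifs <;> ring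

lemma ofReal_Pdec {p : ℝ} (hp0 : 0 ≤ p) (hp1 : p ≤ 1) (m n : Fin 2) (x : ℤ) (t : ℕ) :
    (Pdec p m n x t : ℂ) = density p m t (x, n) (x, n) := by
  rw [Pdec, Complex.ofReal_tsum, ← (hasSum_density hp0 hp1 m t (x, n) (x, n)).tsum_eq]
  refine tsum_congr fun j => ?_
  rw [Complex.mul_conj, Complex.normSq_eq_norm_sq]

/-- Density kernel of the symmetric decoherent walk. -/
def symDensity (p : ℝ) (t : ℕ) (v w : ℤ × Fin 2) : ℂ := (1 / 2) * ∑ m, density p m t v w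

lemma symDensity_zero (p : ℝ) (x y : ℤ) (a b : Fin 2) :
    symDensity p 0 (x, a) (y, b) = if x = 0 ∧ y = 0 ∧ a = b then 1 / 2 else 0 := by
  fin_cases a <;> fin_cases b <;> by_cases hx : x = 0 <;> by_cases hy : y = 0 <;>
    simp [symDensity, density, ket, hx, hy]

lemma symDensity_succ (p : ℝ) (t : ℕ) : symDensity p (t + 1) = densityStep p (symDensity p t) := by
  ext v w
  simp only [symDensity, density, densityStep, conjStep, Fin.sum_univ_two]
  ring

lemma symDensity_eq_zero (p : ℝ) (t : ℕ) (x : ℤ) (a : Fin 2) (w : ℤ × Fin 2)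
    (hx : (t : ℤ) < |x|) : symDensity p t (x, a) w = 0 := by
  induction t generalizing x a w with
  | zero =>
    obtain ⟨y, b⟩ := w
    rw [symDensity_zero, if_neg]
    rintro ⟨rfl, -⟩
    simp at hx
  | succ t ih =>
    have : (t : ℤ) < |x - drift a| := by
      have h1 : |drift a| = 1 := by unfold drift; split_ifs <;> simp
      have h2 := abs_sub_abs_le_abs_sub x (drift a)
      push_cast at hx
      omega
    rw [symDensity_succ, densityStep, conjStep]
    simp [ih _ _ _ this]

/-- The `f`-weighted sum of the kernel `ρ` along the diagonal of offset `d`. -/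
def moment (f : ℤ → ℂ) (ρ : ℤ × Fin 2 → ℤ × Fin 2 → ℂ) (d : ℤ) (a b : Fin 2) : ℂ :=
  ∑' x, f x * ρ (x, a) (x + d, b)

lemma summable_moment (f : ℤ → ℂ) (p : ℝ) (t : ℕ) (d : ℤ) (a b : Fin 2) :
    Summable fun x => f x * symDensity p t (x, a) (x + d, b) := by
  refine summable_of_ne_finset_zero (s := Finset.Icc (-(t : ℤ)) t) fun x hx => ?_
  rw [symDensity_eq_zero, mul_zero]
  by_contra h
  exact hx (Finset.mem_Icc.mpr (abs_le.mp (not_lt.mp h)))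

lemma moment_add (f g : ℤ → ℂ) (p : ℝ) (t : ℕ) (d : ℤ) (a b : Fin 2) :
    moment (fun x => f x + g x) (symDensity p t) d a b
      = moment f (symDensity p t) d a b + moment g (symDensity p t) d a b := by
  simp only [moment, add_mul]
  exact (summable_moment f p t d a b).tsum_add (summable_moment g p t d a b)

lemma moment_const_mul (c : ℂ) (f : ℤ → ℂ) (ρ : ℤ × Fin 2 → ℤ × Fin 2 → ℂ) (d : ℤ)
    (a b : Fin 2) : moment (fun x => c * f x) ρ d a b = c * moment f ρ d a b := by
  simp only [moment, mul_assoc]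
  exact tsum_mul_left

lemma moment_symDensity_succ (f : ℤ → ℂ) (p : ℝ) (t : ℕ) (d : ℤ) (a b : Fin 2) :
    moment f (symDensity p (t + 1)) d a b
      = (if d = 0 ∧ a = b then 1 else 1 - (p : ℂ)) * ((1 / 2) * ∑ a', ∑ b',
          coinSign a a' * coinSign b b' *
            moment (fun x => f (x + drift a)) (symDensity p t) (d + drift a - drift b) a' b') := by
  have hs : HasSum (fun x : ℤ => (1 / 2 : ℂ) * ∑ a', ∑ b', coinSign a a' * coinSign b b' *
        (f (x + drift a) * symDensity p t (x, a') (x + (d + drift a - drift b), b')))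
      ((1 / 2) * ∑ a', ∑ b', coinSign a a' * coinSign b b' *
        moment (fun x => f (x + drift a)) (symDensity p t) (d + drift a - drift b) a' b') :=
    (hasSum_sum fun a' _ => hasSum_sum fun b' _ =>
      ((summable_moment (fun x => f (x + drift a)) p t _ a' b').hasSum).mul_left _).mul_left _
  rw [← hs.tsum_eq, ← (Equiv.subRight (drift a)).tsum_eq, ← tsum_mul_left, moment]
  refine tsum_congr fun x => ?_
  have hcond : ((x, a) = (x + d, b)) ↔ (d = 0 ∧ a = b) := by
    simp [Prod.ext_iff]
  have hy : x - drift a + (d + drift a - drift b) = x + d - drift b := by ring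
  simp only [symDensity_succ, densityStep, conjStep, hcond, Equiv.subRight_apply,
    sub_add_cancel, hy, Fin.sum_univ_two]
  ring

lemma moment_one (p : ℝ) (t : ℕ) (d : ℤ) (a b : Fin 2) :
    moment (fun _ => 1) (symDensity p t) d a b = if d = 0 ∧ a = b then 1 / 2 else 0 := by
  induction t generalizing d a b with
  | zero =>
    rw [moment, tsum_eq_single 0]
    · simp [symDensity_zero]
    · intro x hx
      simp [symDensity_zero, hx]
  | succ t ih =>
    rw [moment_symDensity_succ]
    simp only [ih, Fin.sum_univ_two]
    fin_cases a <;> fin_cases b <;> by_cases hd : d = 0 <;> simp [coinSign, drift, hd] <;>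
      (try split_ifs) <;> norm_num

lemma moment_id_zero (p : ℝ) (d : ℤ) (a b : Fin 2) :
    moment (fun x => (x : ℂ)) (symDensity p 0) d a b = 0 := by
  refine (tsum_congr fun x => ?_).trans tsum_zero
  by_cases hx : x = 0 <;> simp [symDensity_zero, hx]

lemma moment_id_succ (p : ℝ) (t : ℕ) (d : ℤ) (a b : Fin 2) :
    moment (fun x => (x : ℂ)) (symDensity p (t + 1)) d a b
      = (if d = 0 ∧ a = b then 1 else 1 - (p : ℂ)) * ((1 / 2) * ∑ a', ∑ b',
          coinSign a a' * coinSign b b' *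
            moment (fun x => (x : ℂ)) (symDensity p t) (d + drift a - drift b) a' b')
        + if d = 0 ∧ a = b then (drift a : ℂ) / 2 else 0 := by
  have hf : (fun x : ℤ => ((x + drift a : ℤ) : ℂ)) = fun x : ℤ => (x : ℂ) + (drift a : ℂ) * 1 := by
    ext x; push_cast; ring
  rw [moment_symDensity_succ, hf]
  simp only [moment_add, moment_const_mul (drift a : ℂ) (fun _ => (1 : ℂ)), moment_one,
    Fin.sum_univ_two]
  fin_cases a <;> fin_cases b <;> by_cases hd : d = 0 <;> 
    simp [coinSign, drift, hd] <;> ring_nf <;> simp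

/-- Second moment of the symmetric walk at time `t`, as a complex number. -/
def secondMoment (p : ℝ) (t : ℕ) : ℂ :=
  ∑ a, moment (fun x => (x : ℂ) ^ 2) (symDensity p t) 0 a a

lemma secondMoment_zero (p : ℝ) : secondMoment p 0 = 0 := by
  refine Finset.sum_eq_zero fun a _ => ?_
  refine (tsum_congr fun x => ?_).trans tsum_zero
  by_cases hx : x = 0 <;> simp [symDensity_zero, hx]

/-- First moment paired with the Pauli matrix `σ_x`, halved. -/
def firstMomentX (p : ℝ) (t : ℕ) (d : ℤ) : ℂ :=
  (moment (fun x => (x : ℂ)) (symDensity p t) d 0 1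
    + moment (fun x => (x : ℂ)) (symDensity p t) d 1 0) / 2

lemma secondMoment_succ (p : ℝ) (t : ℕ) :
    secondMoment p (t + 1) = secondMoment p t + 1 + 4 * firstMomentX p t 0 := by
  have hf (a : Fin 2) : (fun x : ℤ => ((x + drift a : ℤ) : ℂ) ^ 2)
      = fun x : ℤ => (x : ℂ) ^ 2 + (2 * (drift a : ℂ) * (x : ℂ) + (drift a : ℂ) ^ 2 * 1) := by
    ext x; push_cast; ring
  simp only [secondMoment, moment_symDensity_succ, hf, moment_add,
    moment_const_mul _ (fun x => (x : ℂ)), moment_const_mul _ (fun _ => (1 : ℂ)), moment_one,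
    Fin.sum_univ_two, firstMomentX]
  simp [coinSign, drift]
  ring

/-- The kernel concentrated at the origin. -/
def originDelta : ℤ → ℂ := Pi.single 0 1

/-- `f ↦ (f(· + 2) + f(· - 2)) / 2`, multiplication by `cos θ` in Fourier space. -/
def cosShift : Module.End ℂ (ℤ → ℂ) where
  toFun f d := (f (d + 2) + f (d - 2)) / 2
  map_add' f g := by ext d; simp only [Pi.add_apply]; ring
  map_smul' c f := by ext d; simp only [Pi.smul_apply, smul_eq_mul, RingHom.id_apply]; ring

/-- `f ↦ (f(· + 2) - f(· - 2)) / 2`. -/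
def sinShift : Module.End ℂ (ℤ → ℂ) where
  toFun f d := (f (d + 2) - f (d - 2)) / 2
  map_add' f g := by ext d; simp only [Pi.add_apply]; ring
  map_smul' c f := by ext d; simp only [Pi.smul_apply, smul_eq_mul, RingHom.id_apply]; ring

/-- Multiplication by the index, a derivation in Fourier space. -/
def mulIndex : Module.End ℂ (ℤ → ℂ) where
  toFun f d := d * f d
  map_add' f g := by ext d; simp only [Pi.add_apply]; ring
  map_smul' c f := by ext d; simp only [Pi.smul_apply, smul_eq_mul, RingHom.id_apply]; ring

lemma cosShift_apply (f : ℤ → ℂ) (d : ℤ) : cosShift f d = (f (d + 2) + f (d - 2)) / 2 := rfl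

lemma sinShift_apply (f : ℤ → ℂ) (d : ℤ) : sinShift f d = (f (d + 2) - f (d - 2)) / 2 := rfl

lemma mulIndex_apply (f : ℤ → ℂ) (d : ℤ) : mulIndex f d = d * f d := rfl

lemma mulIndex_originDelta : mulIndex originDelta = 0 := by
  ext d
  by_cases hd : d = 0 <;> simp [mulIndex_apply, originDelta, hd]

lemma mulIndex_cosShift (f : ℤ → ℂ) :
    mulIndex (cosShift f) = cosShift (mulIndex f) - (2 : ℂ) • sinShift f := by
  ext d
  simp only [mulIndex_apply, cosShift_apply, sinShift_apply, Pi.sub_apply, Pi.smul_apply,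
    smul_eq_mul]
  push_cast; ring

lemma mulIndex_sinShift (f : ℤ → ℂ) :
    mulIndex (sinShift f) = sinShift (mulIndex f) - (2 : ℂ) • cosShift f := by
  ext d
  simp only [mulIndex_apply, cosShift_apply, sinShift_apply, Pi.sub_apply, Pi.smul_apply,
    smul_eq_mul]
  push_cast; ring

lemma sinShift_sinShift (f : ℤ → ℂ) : sinShift (sinShift f) = cosShift (cosShift f) - f := by
  ext d
  simp only [cosShift_apply, sinShift_apply, Pi.sub_apply, sub_add_cancel, add_sub_cancel_right]
  ring

lemma sinShift_cosShift (f : ℤ → ℂ) : sinShift (cosShift f) = cosShift (sinShift f) := by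
  ext d
  simp only [cosShift_apply, sinShift_apply, sub_add_cancel, add_sub_cancel_right]
  ring

open Polynomial in
lemma mulIndex_aeval_cosShift (P : ℂ[X]) (f : ℤ → ℂ) :
    mulIndex (aeval cosShift P f)
      = aeval cosShift P (mulIndex f) - (2 : ℂ) • sinShift (aeval cosShift (derivative P) f) := by
  induction P using Polynomial.induction_on generalizing f with
  | C a => simp [Algebra.algebraMap_eq_smul_one]
  | add P Q hP hQ =>
    simp only [map_add, LinearMap.add_apply, hP, hQ]
    module
  | monomial n a ih =>
    have hsplit : (C a * X ^ (n + 1) : ℂ[X]) = X * (C a * X ^ n) := by ring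
    rw [hsplit, derivative_mul, derivative_X, one_mul]
    simp only [map_add, map_mul (aeval cosShift) X, aeval_X, Module.End.mul_apply,
      LinearMap.add_apply, mulIndex_cosShift, ih, map_sub, map_smul, sinShift_cosShift]
    module

/-- Constant term of a polynomial in `cos θ`. -/
def cosMean : Polynomial ℂ →ₗ[ℂ] ℂ where
  toFun P := Polynomial.aeval cosShift P originDelta 0
  map_add' P Q := by simp
  map_smul' c P := by simp

open Polynomial in
lemma cosMean_total_derivative (P : ℂ[X]) :
    cosMean (X * P - (1 - X ^ 2) * derivative P) = 0 := by
  have h := congrFun (mulIndex_sinShift (aeval cosShift P originDelta)) 0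
  rw [mulIndex_aeval_cosShift, mulIndex_originDelta] at h
  simp only [mulIndex_apply, map_zero, zero_sub, map_neg, map_smul, sinShift_sinShift,
    Int.cast_zero, zero_mul, Pi.sub_apply, Pi.neg_apply, Pi.smul_apply, smul_eq_mul] at h
  simp only [cosMean, LinearMap.coe_mk, AddHom.coe_mk, sub_mul, one_mul, pow_two, mul_assoc,
    map_sub, map_mul (aeval cosShift) X, aeval_X, Module.End.mul_apply]
  linear_combination (1 / 2) * h

open Polynomial in
/-- The pair `(sin((s+½)φ)/sin(φ/2), cos((s+½)φ)/cos(φ/2))` as polynomials in `X = cos θ`, where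
`cos φ = -(1 + cos θ)/2`. -/
def halfAngle : ℕ → ℂ[X] × ℂ[X]
  | 0 => (1, 1)
  | s + 1 =>
    (C (-1 / 2) * (1 + X) * (halfAngle s).1 + C (1 / 2) * (1 - X) * (halfAngle s).2,
      C (-1 / 2) * (1 + X) * (halfAngle s).2 - C (1 / 2) * (3 + X) * (halfAngle s).1)

open Polynomial in
lemma halfAngle_fst_add_two (s : ℕ) :
    (halfAngle (s + 2)).1 = -(1 + X) * (halfAngle (s + 1)).1 - (halfAngle s).1 := by
  refine Polynomial.funext fun r => ?_
  simp only [halfAngle, eval_add, eval_sub, eval_mul, eval_C, eval_X, eval_one, eval_neg,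
    eval_ofNat]
  ring

open Polynomial in
lemma derivative_halfAngle (s : ℕ) (r : ℂ) :
    (1 - r) * (derivative (halfAngle s).2).eval r
        = -1 / 2 * ((2 * s + 1) * (halfAngle s).1.eval r - (halfAngle s).2.eval r) ∧
      (3 + r) * (derivative (halfAngle s).1).eval r
        = -1 / 2 * ((halfAngle s).1.eval r - (2 * s + 1) * (halfAngle s).2.eval r) := by
  induction s with
  | zero => simp [halfAngle]
  | succ s ih =>
    obtain ⟨h1, h2⟩ := ih
    simp only [halfAngle, derivative_add, derivative_sub, derivative_mul, derivative_C,
      derivative_one, derivative_X, derivative_ofNat, eval_add, eval_sub, eval_mul, eval_C, eval_X,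
      eval_one, eval_ofNat, eval_zero]
    push_cast
    constructor
    · linear_combination (-1 / 2) * (1 + r) * h1 - (1 / 2) * (1 - r) * h2
    · linear_combination (-1 / 2) * (1 + r) * h2 + (1 / 2) * (3 + r) * h1

open Polynomial in
lemma halfAngle_recurrence (s : ℕ) :
    ((s : ℂ) + 2) • (halfAngle (s + 2)).1 + ((s : ℂ) + 1) • (halfAngle s).1
      = -(X * (halfAngle (s + 1)).2 - (1 - X ^ 2) * derivative (halfAngle (s + 1)).2) := by
  refine Polynomial.funext fun r => ?_
  have h1 := (derivative_halfAngle (s + 1) r).1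
  rw [halfAngle_fst_add_two]
  generalize derivative (halfAngle (s + 1)).2 = D at h1 ⊢
  simp only [halfAngle, eval_add, eval_sub, eval_mul, eval_C, eval_X, eval_one, eval_neg,
    eval_ofNat, eval_smul, eval_pow, smul_eq_mul] at h1 ⊢
  push_cast at h1
  linear_combination -(1 + r) * h1

lemma cosMean_halfAngle_add_two (s : ℕ) :
    ((s : ℂ) + 2) * cosMean (halfAngle (s + 2)).1 + ((s : ℂ) + 1) * cosMean (halfAngle s).1 = 0 := by
  have h := congrArg cosMean (halfAngle_recurrence s)
  rwa [map_add, map_smul, map_smul, map_neg, cosMean_total_derivative, neg_zero] at h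

lemma cosMean_halfAngle_even (n : ℕ) :
    cosMean (halfAngle (2 * n)).1 = Ring.choose (-(1 / 2) : ℂ) n := by
  induction n with
  | zero => simp [halfAngle, cosMean, originDelta]
  | succ n ih =>
    have h := cosMean_halfAngle_add_two (2 * n)
    have hc : ((n : ℂ) + 1) * Ring.choose (-(1 / 2) : ℂ) (n + 1)
        = (-(1 / 2) - n) * Ring.choose (-(1 / 2) : ℂ) n := by
      have hf : (n.factorial : ℂ) ≠ 0 := Nat.cast_ne_zero.mpr n.factorial_ne_zero
      have hn : ((n : ℂ) + 1) ≠ 0 := Nat.cast_add_one_ne_zero n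
      rw [Ring.choose_eq_smul, Ring.choose_eq_smul, descPochhammer_succ_right,
        Polynomial.smeval_mul, Polynomial.smeval_sub, Polynomial.smeval_X,
        Polynomial.smeval_natCast, Nat.factorial_succ]
      simp only [pow_one, pow_zero, smul_eq_mul, nsmul_eq_mul, mul_one]
      push_cast
      field_simp
    have hn : (2 * ((n : ℂ) + 1)) ≠ 0 := mul_ne_zero two_ne_zero (Nat.cast_add_one_ne_zero n)
    refine mul_left_cancel₀ hn ?_
    rw [ih] at h
    push_cast at h
    rw [show 2 * (n + 1) = 2 * n + 2 by ring]
    linear_combination h - 2 * hc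

lemma cosMean_halfAngle_odd (n : ℕ) : cosMean (halfAngle (2 * n + 1)).1 = 0 := by
  induction n with
  | zero =>
    have h : (halfAngle 1).1 = -Polynomial.X := by
      refine Polynomial.funext fun r => ?_
      simp [halfAngle]
      ring
    simp [h, cosMean, cosShift_apply, originDelta]
  | succ n ih =>
    have h := cosMean_halfAngle_add_two (2 * n + 1)
    rw [ih, mul_zero, add_zero] at h
    refine (mul_eq_zero.mp h).resolve_left ?_
    exact_mod_cast (by omega : 2 * n + 1 + 2 ≠ 0)

lemma hasSum_cosMean_halfAngle {w : ℂ} (hw : ‖w‖ < 1) :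
    HasSum (fun s => cosMean (halfAngle s).1 * w ^ s) ((1 + w ^ 2) ^ (-(1 / 2) : ℂ)) := by
  have hball : w ^ 2 ∈ Metric.eball (0 : ℂ) 1 := by
    rw [Metric.mem_eball, edist_zero_right, ← ofReal_norm, ENNReal.ofReal_lt_one, norm_pow]
    exact pow_lt_one₀ (norm_nonneg w) hw two_ne_zero
  have h := (Complex.one_add_cpow_hasFPowerSeriesOnBall_zero (a := (-(1 / 2) : ℂ))).hasSum hball
  simp only [binomialSeries_apply, List.ofFn_const, List.prod_replicate, smul_eq_mul,
    zero_add] at h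
  rw [← add_zero ((1 + w ^ 2) ^ (-(1 / 2) : ℂ))]
  refine HasSum.even_add_odd ?_ ?_
  · simpa only [cosMean_halfAngle_even, pow_mul] using h
  · simp [cosMean_halfAngle_odd]

/-- Triples of kernels: the `σ_z`, `σ_x` and `iσ_y` components of a translation-covariant
traceless kernel. -/
abbrev BlochState := (ℤ → ℂ) × (ℤ → ℂ) × (ℤ → ℂ)

/-- Conjugation by `U` on traceless covariant kernels. -/
def blochStep : Module.End ℂ BlochState where
  toFun v := (v.2.1, cosShift v.1 - sinShift v.2.2, sinShift v.1 - cosShift v.2.2)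
  map_add' v w := by
    ext <;> simp only [Prod.fst_add, Prod.snd_add, map_add, Pi.add_apply, Pi.sub_apply] <;> ring
  map_smul' c v := by
    ext <;> simp only [Prod.smul_fst, Prod.smul_snd, map_smul, Pi.smul_apply, Pi.sub_apply,
      smul_eq_mul, RingHom.id_apply] <;> ring

/-- The localized `σ_z` kernel. -/
def pauliZ : BlochState := (originDelta, 0, 0)

/-- Bloch components of the first-moment kernel of the symmetric walk. -/
def firstMoment (p : ℝ) (t : ℕ) : BlochState :=
  (fun d => moment (fun x => (x : ℂ)) (symDensity p t) d 0 0, firstMomentX p t,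
    fun d => (moment (fun x => (x : ℂ)) (symDensity p t) d 0 1
      - moment (fun x => (x : ℂ)) (symDensity p t) d 1 0) / 2)

lemma moment_id_one_one (p : ℝ) (t : ℕ) (d : ℤ) :
    moment (fun x => (x : ℂ)) (symDensity p t) d 1 1
      = -moment (fun x => (x : ℂ)) (symDensity p t) d 0 0 := by
  induction t generalizing d with
  | zero => simp [moment_id_zero]
  | succ t ih =>
    rw [moment_id_succ, moment_id_succ]
    by_cases hd : d = 0 <;> simp [coinSign, drift, hd, ih] <;> ring

lemma firstMoment_zero (p : ℝ) : firstMoment p 0 = 0 := by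
  ext d <;> simp [firstMoment, firstMomentX, moment_id_zero]

lemma firstMoment_succ (p : ℝ) (t : ℕ) :
    firstMoment p (t + 1) = (1 - (p : ℂ)) • blochStep (firstMoment p t)
      + ((p : ℂ) * firstMomentX p t 0 + 1 / 2) • pauliZ := by
  ext d
  · simp only [firstMoment, moment_id_succ, blochStep, pauliZ, originDelta]
    by_cases hd : d = 0
    · simp [coinSign, drift, hd, moment_id_one_one, firstMomentX]
      ring
    · simp [coinSign, drift, hd, moment_id_one_one, firstMomentX, -mul_eq_mul_left_iff]
      ring
  · simp only [firstMoment, firstMomentX, moment_id_succ, blochStep, pauliZ]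
    simp [coinSign, drift, moment_id_one_one, cosShift_apply, sinShift_apply]
    ring_nf
  · simp only [firstMoment, firstMomentX, moment_id_succ, blochStep, pauliZ]
    simp [coinSign, drift, moment_id_one_one, cosShift_apply, sinShift_apply]
    ring_nf

lemma firstMoment_eq_sum (p : ℝ) (t : ℕ) :
    firstMoment p (t + 1) = ∑ s ∈ Finset.range (t + 1),
      ((1 - (p : ℂ)) ^ s * ((p : ℂ) * firstMomentX p (t - s) 0 + 1 / 2)) •
        (blochStep ^ s) pauliZ := by
  induction t with
  | zero => simp [firstMoment_succ, firstMoment_zero]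
  | succ t ih =>
    rw [firstMoment_succ, ih, Finset.sum_range_succ' _ (t + 1), map_sum, Finset.smul_sum]
    congr 1
    · refine Finset.sum_congr rfl fun s _ => ?_
      rw [map_smul, smul_smul, pow_succ' blochStep, Module.End.mul_apply, Nat.add_sub_add_right]
      congr 1
      ring
    · simp

/-- Localized `σ_x` component after `s` coherent steps from the localized `σ_z` kernel. -/
def coherentX (s : ℕ) : ℂ := ((blochStep ^ s) pauliZ).2.1 0

lemma firstMomentX_succ (p : ℝ) (t : ℕ) :
    firstMomentX p (t + 1) 0 = ∑ s ∈ Finset.range (t + 1),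
      ((1 - (p : ℂ)) ^ s * coherentX s) * ((p : ℂ) * firstMomentX p (t - s) 0 + 1 / 2) := by
  have h : firstMomentX p (t + 1) 0 = (firstMoment p (t + 1)).2.1 0 := rfl
  rw [h, firstMoment_eq_sum, Prod.snd_sum, Prod.fst_sum, Finset.sum_apply]
  refine Finset.sum_congr rfl fun s _ => ?_
  simp only [Prod.smul_snd, Prod.smul_fst, Pi.smul_apply, smul_eq_mul, coherentX]
  ring

lemma blochStep_pow_fst (s : ℕ) (v : BlochState) :
    ((blochStep ^ (s + 1)) v).1 = ((blochStep ^ s) v).2.1 := by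
  rw [pow_succ', Module.End.mul_apply]
  rfl

lemma blochStep_x_add_two (v : BlochState) :
    (blochStep (blochStep v)).2.1
      = -cosShift (blochStep v).2.1 + cosShift v.2.1 + v.1 := by
  simp only [blochStep, LinearMap.coe_mk, AddHom.coe_mk, map_sub, sinShift_sinShift,
    sinShift_cosShift]
  module

open Polynomial in
lemma aeval_halfAngle (s : ℕ) :
    aeval cosShift (halfAngle (s + 1)).1 originDelta
        = ((blochStep ^ s) pauliZ).2.1 - ((blochStep ^ (s + 1)) pauliZ).2.1 ∧
      aeval cosShift (halfAngle (s + 2)).1 originDelta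
        = ((blochStep ^ (s + 1)) pauliZ).2.1 - ((blochStep ^ (s + 2)) pauliZ).2.1 := by
  induction s with
  | zero =>
    have h : (halfAngle 1).1 = -X := by
      refine Polynomial.funext fun r => ?_
      simp [halfAngle]
      ring
    have h1 : aeval cosShift (halfAngle 1).1 originDelta = -cosShift originDelta := by simp [h]
    have hb : (blochStep pauliZ).2.1 = cosShift originDelta := by simp [blochStep, pauliZ]
    have h0 : aeval cosShift (halfAngle 0).1 originDelta = originDelta := by simp [halfAngle]
    rw [zero_add, zero_add, pow_zero, pow_one, hb, h1]
    refine ⟨by simp [pauliZ], ?_⟩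
    rw [← zero_add 2, halfAngle_fst_add_two, zero_add, zero_add, pow_two, Module.End.mul_apply,
      blochStep_x_add_two, hb, map_sub, map_mul, map_neg, map_add, map_one, aeval_X]
    simp only [LinearMap.sub_apply, Module.End.mul_apply, LinearMap.neg_apply, LinearMap.add_apply,
      Module.End.one_apply, h0, h1]
    simp only [pauliZ, map_neg, map_zero]
    module
  | succ s ih =>
    obtain ⟨h1, h2⟩ := ih
    refine ⟨h2, ?_⟩
    rw [halfAngle_fst_add_two, map_sub, map_mul, map_neg, map_add, map_one, aeval_X]
    simp only [LinearMap.sub_apply, Module.End.mul_apply, LinearMap.neg_apply, LinearMap.add_apply,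
      Module.End.one_apply, h1, h2]
    have h3 : (blochStep ^ (s + 1 + 2)) pauliZ
        = blochStep (blochStep ((blochStep ^ (s + 1)) pauliZ)) := by
      rw [pow_succ', pow_succ']; rfl
    have h4 : (blochStep ^ (s + 2)) pauliZ = blochStep ((blochStep ^ (s + 1)) pauliZ) := by
      rw [pow_succ']; rfl
    rw [h3, blochStep_x_add_two, blochStep_pow_fst, ← h4, map_sub]
    module

lemma coherentX_eq_sum (s : ℕ) :
    coherentX s = ∑ i ∈ Finset.range (s + 1),
      ((if i = 0 then 1 else 0) - cosMean (halfAngle i).1) := by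
  induction s with
  | zero => simp [coherentX, pauliZ, halfAngle, cosMean, originDelta]
  | succ s ih =>
    rw [Finset.sum_range_succ, ← ih]
    have h : cosMean (halfAngle (s + 1)).1 = coherentX s - coherentX (s + 1) :=
      congrFun (aeval_halfAngle s).1 0
    simp [h]

lemma summable_norm_geometric {z : ℂ} (hz : ‖z‖ < 1) : Summable fun t : ℕ => ‖z ^ t‖ := by
  simpa [norm_pow] using summable_geometric_of_lt_one (norm_nonneg z) hz

lemma summable_norm_mul_coherentX_and_tsum {w : ℂ} (hw : ‖w‖ < 1) :
    (Summable fun s => ‖coherentX s * w ^ s‖) ∧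
      (1 - w) * ∑' s, coherentX s * w ^ s = 1 - (1 + w ^ 2) ^ (-(1 / 2) : ℂ) := by
  have h1 : HasSum (fun s : ℕ => ((if s = 0 then 1 else 0) - cosMean (halfAngle s).1) * w ^ s)
      (1 - (1 + w ^ 2) ^ (-(1 / 2) : ℂ)) := by
    refine ((hasSum_ite_eq (0 : ℕ) (1 : ℂ)).sub (hasSum_cosMean_halfAngle hw)).congr_fun
      fun s => ?_
    by_cases hs : s = 0 <;> simp [hs]
  have hg := summable_norm_geometric hw
  have h1n := h1.summable.norm
  have hconv (s : ℕ) : coherentX s * w ^ s = ∑ i ∈ Finset.range (s + 1),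
      (((if i = 0 then 1 else 0) - cosMean (halfAngle i).1) * w ^ i) * w ^ (s - i) := by
    rw [coherentX_eq_sum, Finset.sum_mul]
    refine Finset.sum_congr rfl fun i hi => ?_
    rw [mul_assoc, ← pow_add, Nat.add_sub_cancel' (Finset.mem_range_succ_iff.mp hi)]
  simp only [hconv]
  refine ⟨summable_norm_sum_mul_range_of_summable_norm h1n hg, ?_⟩
  rw [← tsum_mul_tsum_eq_tsum_sum_range_of_summable_norm h1n hg, h1.tsum_eq,
    tsum_geometric_of_norm_lt_one hw]
  have hw1 : 1 - w ≠ 0 := sub_ne_zero.mpr fun h => by simp [← h] at hw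
  field_simp

lemma ofReal_PsymProb {p : ℝ} (hp0 : 0 ≤ p) (hp1 : p ≤ 1) (x : ℤ) (t : ℕ) :
    (PsymProb p x t : ℂ) = ∑ a, symDensity p t (x, a) (x, a) := by
  simp only [PsymProb, symDensity, Fin.sum_univ_two]
  push_cast
  simp only [ofReal_Pdec hp0 hp1]
  ring

lemma hasSum_mul_PsymProb {p : ℝ} (hp0 : 0 ≤ p) (hp1 : p ≤ 1) (f : ℤ → ℂ) (t : ℕ) :
    HasSum (fun x => f x * (PsymProb p x t : ℂ)) (∑ a, moment f (symDensity p t) 0 a a) := by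
  simp only [ofReal_PsymProb hp0 hp1, Finset.mul_sum]
  refine hasSum_sum fun a _ => ?_
  simpa only [moment, add_zero] using (summable_moment f p t 0 a a).hasSum

lemma hasSum_PsymProb {p : ℝ} (hp0 : 0 ≤ p) (hp1 : p ≤ 1) (t : ℕ) :
    HasSum (fun x => PsymProb p x t) 1 := by
  have h := hasSum_mul_PsymProb hp0 hp1 (fun _ => 1) t
  simp only [moment_one, one_mul, Fin.sum_univ_two] at h
  rw [← Complex.hasSum_ofReal]
  convert h using 1
  norm_num

lemma hasSum_sq_mul_PsymProb {p : ℝ} (hp0 : 0 ≤ p) (hp1 : p ≤ 1) (t : ℕ) :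
    HasSum (fun x : ℤ => (((x : ℝ) ^ 2 * PsymProb p x t : ℝ) : ℂ)) (secondMoment p t) := by
  simpa [secondMoment] using hasSum_mul_PsymProb hp0 hp1 (fun x => (x : ℂ) ^ 2) t

lemma ofReal_tsum_sq_mul_PsymProb {p : ℝ} (hp0 : 0 ≤ p) (hp1 : p ≤ 1) (t : ℕ) :
    ((∑' x : ℤ, (x : ℝ) ^ 2 * PsymProb p x t : ℝ) : ℂ) = secondMoment p t := by
  rw [Complex.ofReal_tsum, (hasSum_sq_mul_PsymProb hp0 hp1 t).tsum_eq]

lemma PsymProb_nonneg (p : ℝ) (x : ℤ) (t : ℕ) : 0 ≤ PsymProb p x t :=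
  mul_nonneg (by norm_num) <| Finset.sum_nonneg fun _ _ => Finset.sum_nonneg fun _ _ =>
    tsum_nonneg fun _ => by positivity

lemma PsymProb_eq_zero {p : ℝ} (hp0 : 0 ≤ p) (hp1 : p ≤ 1) {x : ℤ} {t : ℕ} (hx : (t : ℤ) < |x|) :
    PsymProb p x t = 0 := by
  rw [← Complex.ofReal_eq_zero, ofReal_PsymProb hp0 hp1]
  exact Finset.sum_eq_zero fun a _ => symDensity_eq_zero p t x a _ hx

lemma norm_secondMoment_le {p : ℝ} (hp0 : 0 ≤ p) (hp1 : p ≤ 1) (t : ℕ) :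
    ‖secondMoment p t‖ ≤ (t : ℝ) ^ 2 := by
  have hs : Summable fun x : ℤ => (x : ℝ) ^ 2 * PsymProb p x t :=
    Complex.summable_ofReal.mp (hasSum_sq_mul_PsymProb hp0 hp1 t).summable
  rw [← ofReal_tsum_sq_mul_PsymProb hp0 hp1, Complex.norm_real, Real.norm_of_nonneg
    (tsum_nonneg fun x => mul_nonneg (sq_nonneg _) (PsymProb_nonneg p x t))]
  have h1 := (hasSum_PsymProb hp0 hp1 t).mul_left ((t : ℝ) ^ 2)
  rw [mul_one] at h1
  refine hasSum_le (fun x => ?_) hs.hasSum h1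
  rcases lt_or_ge (t : ℤ) |x| with hx | hx
  · simp [PsymProb_eq_zero hp0 hp1 hx]
  · refine mul_le_mul_of_nonneg_right (sq_le_sq.mpr ?_) (PsymProb_nonneg p x t)
    rw [Nat.abs_cast]
    exact_mod_cast hx

lemma summable_norm_secondMoment {p : ℝ} (hp0 : 0 ≤ p) (hp1 : p ≤ 1) {z : ℂ} (hz : ‖z‖ < 1) :
    Summable fun t => ‖secondMoment p t * z ^ t‖ := by
  refine .of_nonneg_of_le (fun t => norm_nonneg _) (fun t => ?_)
    (summable_norm_pow_mul_geometric_of_norm_lt_one 2 hz)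
  simp only [norm_mul, norm_pow, Complex.norm_natCast]
  exact mul_le_mul_of_nonneg_right (norm_secondMoment_le hp0 hp1 t) (by positivity)

lemma summable_norm_firstMomentX {p : ℝ} (hp0 : 0 ≤ p) (hp1 : p ≤ 1) {z : ℂ} (hz : ‖z‖ < 1) :
    Summable fun t => ‖firstMomentX p t 0 * z ^ t‖ := by
  refine .of_nonneg_of_le (fun t => norm_nonneg _) (fun t => ?_)
    ((summable_norm_pow_mul_geometric_of_norm_lt_one 2 hz).add (summable_norm_geometric hz))
  have h : firstMomentX p t 0 = (secondMoment p (t + 1) - secondMoment p t - 1) / 4 := by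
    rw [secondMoment_succ]
    ring
  have hle : ‖firstMomentX p t 0‖ ≤ (t : ℝ) ^ 2 + 1 := by
    have h1 := norm_sub_le (secondMoment p (t + 1) - secondMoment p t) 1
    have h2 := norm_sub_le (secondMoment p (t + 1)) (secondMoment p t)
    have h3 := norm_secondMoment_le hp0 hp1 (t + 1)
    have h4 := norm_secondMoment_le hp0 hp1 t
    rw [h, norm_div, div_le_iff₀ (by norm_num)]
    push_cast at h3
    rw [norm_one] at h1
    norm_num
    nlinarith [sq_nonneg ((t : ℝ) - 1)]
  simp only [norm_mul, norm_pow, Complex.norm_natCast]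
  calc ‖firstMomentX p t 0‖ * ‖z‖ ^ t ≤ ((t : ℝ) ^ 2 + 1) * ‖z‖ ^ t := by gcongr
    _ = _ := by ring

/-- Renewal equation for the generating function of `firstMomentX`. -/
lemma tsum_firstMomentX {p : ℝ} (hp0 : 0 ≤ p) (hp1 : p ≤ 1) {z : ℂ} (hz : ‖z‖ < 1)
    (hw : ‖(1 - (p : ℂ)) * z‖ < 1) :
    ∑' t, firstMomentX p t 0 * z ^ t
      = z * ((∑' s, coherentX s * ((1 - (p : ℂ)) * z) ^ s)
        * ((p : ℂ) * ∑' t, firstMomentX p t 0 * z ^ t + 1 / 2 * (1 - z)⁻¹)) := by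
  have hX := summable_norm_firstMomentX hp0 hp1 hz
  have hg := summable_norm_geometric hz
  have hsum : HasSum (fun t => ((p : ℂ) * firstMomentX p t 0 + 1 / 2) * z ^ t)
      ((p : ℂ) * ∑' t, firstMomentX p t 0 * z ^ t + 1 / 2 * (1 - z)⁻¹) := by
    refine ((hX.of_norm.hasSum.mul_left (p : ℂ)).add
      ((hasSum_geometric_of_norm_lt_one hz).mul_left (1 / 2))).congr_fun fun t => ?_
    ring
  have hn : Summable fun t => ‖((p : ℂ) * firstMomentX p t 0 + 1 / 2) * z ^ t‖ :=
    hsum.summable.norm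
  rw [← hsum.tsum_eq, tsum_mul_tsum_eq_tsum_sum_range_of_summable_norm
    (summable_norm_mul_coherentX_and_tsum hw).1 hn, ← tsum_mul_left, hX.of_norm.tsum_eq_zero_add]
  have h0 : firstMomentX p 0 0 = 0 := by simp [firstMomentX, moment_id_zero]
  rw [h0, zero_mul, zero_add]
  refine tsum_congr fun t => ?_
  rw [firstMomentX_succ, Finset.sum_mul, Finset.mul_sum]
  refine Finset.sum_congr rfl fun s hs => ?_
  have ht : z ^ (t + 1) = z * (z ^ s * z ^ (t - s)) := by
    rw [← pow_add, Nat.add_sub_cancel' (Finset.mem_range_succ_iff.mp hs), pow_succ']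
  rw [ht, mul_pow]
  ring

lemma tsum_secondMoment {p : ℝ} (hp0 : 0 ≤ p) (hp1 : p ≤ 1) {z : ℂ} (hz : ‖z‖ < 1) :
    (1 - z) * ∑' t, secondMoment p t * z ^ t
      = z * ((1 - z)⁻¹ + 4 * ∑' t, firstMomentX p t 0 * z ^ t) := by
  have hM := (summable_norm_secondMoment hp0 hp1 hz).of_norm
  have hX := (summable_norm_firstMomentX hp0 hp1 hz).of_norm
  have hsum := HasSum.tsum_eq <| ((hM.hasSum.add (hasSum_geometric_of_norm_lt_one hz)).add
    (hX.hasSum.mul_left 4)).mul_left z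
  have h := hM.tsum_eq_zero_add
  rw [secondMoment_zero, zero_mul, zero_add] at h
  have h2 (t : ℕ) : secondMoment p (t + 1) * z ^ (t + 1)
      = z * (secondMoment p t * z ^ t + z ^ t + 4 * (firstMomentX p t 0 * z ^ t)) := by
    rw [secondMoment_succ, pow_succ]
    ring
  rw [tsum_congr h2] at h
  linear_combination h + hsum

/-- Generating function of the second moments of the symmetric decoherent Hadamard walk:
`Σ_{t≥0} (Σ_x x² P(X_t = x)) z^t
  = z/(1-z)² + 2z²(√(1+q²z²) - 1)/((1-z)²(pz + (1-z)√(1+q²z²)))`. -/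
theorem second_moment_generating_function (p q : ℝ)
    (hp0 : 0 < p) (hp1 : p ≤ 1) (hq : q = 1 - p) (z : ℂ) (hz : ‖z‖ < 1) :
    ∑' t : ℕ, (((∑' x : ℤ, (x : ℝ) ^ 2 * PsymProb p x t) : ℝ) : ℂ) * z ^ t
      = z / (1 - z) ^ 2
        + 2 * z ^ 2 * ((1 + (q : ℂ) ^ 2 * z ^ 2) ^ ((1 : ℂ) / 2) - 1)
          / ((1 - z) ^ 2 *
              ((p : ℂ) * z + (1 - z) * (1 + (q : ℂ) ^ 2 * z ^ 2) ^ ((1 : ℂ) / 2))) := by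
  subst hq
  have hw : ‖(1 - (p : ℂ)) * z‖ < 1 := by
    have h1 : ‖1 - (p : ℂ)‖ ≤ 1 := by
      rw [← Complex.ofReal_one, ← Complex.ofReal_sub, Complex.norm_real, Real.norm_eq_abs, abs_le]
      constructor <;> linarith
    rw [norm_mul]
    exact (mul_le_of_le_one_left (norm_nonneg z) h1).trans_lt hz
  have hz1 : 1 - z ≠ 0 := sub_ne_zero.mpr fun h => by simp [← h] at hz
  have hw1 : 1 - (1 - (p : ℂ)) * z ≠ 0 := sub_ne_zero.mpr fun h => by simp [← h] at hw
  have hw2 : 1 + ((1 - (p : ℂ)) * z) ^ 2 ≠ 0 := fun h => by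
    have h1 : ‖((1 - (p : ℂ)) * z) ^ 2‖ < 1 := by
      rw [norm_pow]
      exact pow_lt_one₀ (norm_nonneg _) hw two_ne_zero
    rw [eq_neg_of_add_eq_zero_right h, norm_neg, norm_one] at h1
    exact h1.false
  simp only [ofReal_tsum_sq_mul_PsymProb hp0.le hp1]
  push_cast
  rw [← mul_pow]
  have hM := tsum_secondMoment hp0.le hp1 hz
  have hX := tsum_firstMomentX hp0.le hp1 hz hw
  have ha := (summable_norm_mul_coherentX_and_tsum hw).2
  rw [Complex.cpow_neg] at ha
  set s := (1 + ((1 - (p : ℂ)) * z) ^ 2) ^ (1 / 2 : ℂ)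
  have hs : s ≠ 0 := (Complex.cpow_ne_zero_iff_of_exponent_ne_zero (by norm_num)).mpr hw2
  clear_value s
  generalize (∑' t, secondMoment p t * z ^ t) = M at hM ⊢
  generalize (∑' t, firstMomentX p t 0 * z ^ t) = x at hM hX
  generalize (∑' s, coherentX s * ((1 - (p : ℂ)) * z) ^ s) = a at ha hX
  have hX1 : x * (1 - z * p * a) = z * a / (2 * (1 - z)) := by
    field_simp at hX ⊢
    linear_combination hX
  have hne : 1 - z * p * a ≠ 0 := fun h => by
    rw [h, mul_zero, eq_comm, div_eq_zero_iff, mul_eq_zero] at hX1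
    rcases hX1 with (h1 | h1) | h1
    · simp [h1] at h
    · simp [h1] at h
    · exact mul_ne_zero two_ne_zero hz1 h1
  have ha1 : s - 1 = s * (1 - (1 - (p : ℂ)) * z) * a := by
    field_simp at ha
    linear_combination -ha
  have hB : (p : ℂ) * z + (1 - z) * s = s * (1 - (1 - (p : ℂ)) * z) * (1 - z * p * a) := by
    linear_combination -(p : ℂ) * z * ha1
  have hx : x = z * a / (2 * (1 - z)) / (1 - z * p * a) := (eq_div_iff hne).mpr hX1
  rw [hB, ha1]
  refine mul_left_cancel₀ hz1 (hM.trans ?_)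
  rw [hx]
  generalize 1 - z * (p : ℂ) * a = c at hne
  generalize 1 - (1 - (p : ℂ)) * z = e at hw1
  field_simp
  ring

end
end
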